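/- For every constant C ∈ [0,∞) there exists a matrix Q ∈ ℝ^{2×2} (namely Q = [[0, -n], [n, 0]] for n ∈ ℕ with n > C) such that e^{tQ} is an isometry of ℝ² with the Euclidean norm for every t ∈ ℝ (so sup_{t ∈ [-1,∞)} ‖e^{tQ}‖ = 1), while the Euclidean operator norm of Q equals n > C. In particular, the positivity assumption cannot be dropped from the uniform bound ‖Q‖ ≤ C(M) for generators of bounded semigroups, not even in fixed finite dimension. -/

import Mathlib

open scoped Matrix

/-- The linear map `x ↦ A *ᵥ x` as a continuous linear map on `ℝ²` endowed with the
Euclidean norm. -/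
noncomputable def Matrix.toL2CLM (A : Matrix (Fin 2) (Fin 2) ℝ) :
    EuclideanSpace ℝ (Fin 2) →L[ℝ] EuclideanSpace ℝ (Fin 2) :=
  LinearMap.toContinuousLinearMap <|
    (WithLp.linearEquiv 2 ℝ (∀ _ : Fin 2, ℝ)).symm.toLinearMap ∘ₗ
      A.mulVecLin ∘ₗ (WithLp.linearEquiv 2 ℝ (∀ _ : Fin 2, ℝ)).toLinearMap

/-- The operator norm of a `2 × 2` real matrix induced by the Euclidean norm on `ℝ²`. -/
noncomputable def Matrix.l2OpNorm (A : Matrix (Fin 2) (Fin 2) ℝ) : ℝ :=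
  ‖A.toL2CLM‖

theorem Matrix.norm_toL2CLM_apply_of_transpose_mul_self {A : Matrix (Fin 2) (Fin 2) ℝ} {c : ℝ}
    (hc : 0 ≤ c) (hA : Aᵀ * A = c ^ 2 • (1 : Matrix (Fin 2) (Fin 2) ℝ))
    (x : EuclideanSpace ℝ (Fin 2)) : ‖A.toL2CLM x‖ = c * ‖x‖ := by
  have hdot (v : EuclideanSpace ℝ (Fin 2)) : ‖v‖ ^ 2 = v.ofLp ⬝ᵥ v.ofLp := by
    simp [EuclideanSpace.real_norm_sq_eq, dotProduct, ← sq]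
  have hcoe : (A.toL2CLM x).ofLp = A *ᵥ x.ofLp := rfl
  rw [← sq_eq_sq₀ (norm_nonneg _) (by positivity), mul_pow, hdot, hdot, hcoe,
    Matrix.dotProduct_mulVec, Matrix.vecMul_mulVec, hA, ← Matrix.dotProduct_mulVec]
  simp [Matrix.smul_mulVec]

theorem Matrix.l2OpNorm_of_transpose_mul_self {A : Matrix (Fin 2) (Fin 2) ℝ} {c : ℝ}
    (hc : 0 ≤ c) (hA : Aᵀ * A = c ^ 2 • (1 : Matrix (Fin 2) (Fin 2) ℝ)) :
    A.l2OpNorm = c :=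
  ContinuousLinearMap.opNorm_eq_of_bounds hc
    (fun x ↦ (norm_toL2CLM_apply_of_transpose_mul_self hc hA x).le) fun N _ hN ↦ by
      obtain ⟨x, hx⟩ := exists_norm_eq (EuclideanSpace ℝ (Fin 2)) zero_le_one
      simpa [norm_toL2CLM_apply_of_transpose_mul_self hc hA, hx] using hN x

theorem Matrix.transpose_exp_mul_exp_of_transpose_eq_neg {A : Matrix (Fin 2) (Fin 2) ℝ}
    (hA : Aᵀ = -A) : (NormedSpace.exp A)ᵀ * NormedSpace.exp A = 1 := by
  rw [← Matrix.exp_transpose, hA,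
    ← Matrix.exp_add_of_commute _ _ (Commute.refl A).neg_left, neg_add_cancel,
    NormedSpace.exp_zero]

/-- For every constant `C ∈ [0,∞)` there is a matrix `Q ∈ ℝ^{2×2}`, namely
`Q = [[0, -n], [n, 0]]` for any `n ∈ ℕ` with `n > C`, such that `e^{tQ}` is an isometry
of `ℝ²` with the Euclidean norm for every `t ∈ ℝ` (so `sup_{t ∈ [-1,∞)} ‖e^{tQ}‖ = 1`),
while the Euclidean operator norm of `Q` equals `n > C`.  Hence the positivity assumption
cannot be dropped from the uniform bound for generators of bounded semigroups. -/
theorem positivity_cannot_be_dropped (C : ℝ) (hC : 0 ≤ C) :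
    ∃ n : ℕ, C < (n : ℝ) ∧
      (∀ t : ℝ,
        Isometry (Matrix.toL2CLM (NormedSpace.exp (t • !![0, -(n : ℝ); n, 0])))) ∧
      (⨆ t : Set.Ici (-1 : ℝ),
        Matrix.l2OpNorm (NormedSpace.exp ((t : ℝ) • !![0, -(n : ℝ); n, 0]))) = 1 ∧
      Matrix.l2OpNorm !![0, -(n : ℝ); n, 0] = n := by
  obtain ⟨n, hn⟩ := exists_nat_gt C
  have hexp (t : ℝ) : (NormedSpace.exp (t • !![0, -(n : ℝ); n, 0]))ᵀ *
      NormedSpace.exp (t • !![0, -(n : ℝ); n, 0]) =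
        (1 : ℝ) ^ 2 • (1 : Matrix (Fin 2) (Fin 2) ℝ) := by
    rw [one_pow, one_smul]
    apply Matrix.transpose_exp_mul_exp_of_transpose_eq_neg
    ext i j
    fin_cases i <;> fin_cases j <;> simp
  refine ⟨n, hn, fun t ↦ ?_, ?_, ?_⟩
  · refine AddMonoidHomClass.isometry_of_norm _ fun x ↦ ?_
    rw [Matrix.norm_toL2CLM_apply_of_transpose_mul_self zero_le_one (hexp t), one_mul]
  · simp_rw [Matrix.l2OpNorm_of_transpose_mul_self zero_le_one (hexp _)]
    exact ciSup_const
  · apply Matrix.l2OpNorm_of_transpose_mul_self n.cast_nonneg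
    ext i j
    fin_cases i <;> fin_cases j <;> simp [Matrix.mul_apply, sq]
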